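/- Let ζ ∈ (0,∞)^V, and for each i ∈ V let μ_i be the Inverse Gaussian measure IG(ζ_i/θ_i, ζ_i²) on ℝ, i.e. the measure with density t ↦ 1_{t>0} · ζ_i/√(2π t³) · exp(−(ζ_i − θ_i t)²/(2t)). Then the pushforward of the product measure ν_V^{W,θ,η} ⊗ (⊗_{i∈V} μ_i) on ℝ^V × ℝ^V under the map (δ, A) ↦ δ + A/2 (componentwise: (δ_i + A_i/2)_{i∈V}) equals ν_V^{W,θ,η+ζ}. -/

import Mathlib

open MeasureTheory Matrix

variable {V : Type*}

/-- `H_β = 2 diag(β) − W`. -/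
noncomputable def Hmat [Fintype V] [DecidableEq V] (W : Matrix V V ℝ) (β : V → ℝ) :
    Matrix V V ℝ :=
  Matrix.diagonal (fun i => 2 * β i) - W

/-- Density of the measure `ν_V^{W,θ,η}` with respect to Lebesgue measure on `ℝ^V`. -/
noncomputable def nuDensity [Fintype V] [DecidableEq V] (W : Matrix V V ℝ) (θ η : V → ℝ)
    (β : V → ℝ) : ℝ :=
  Set.indicator {β : V → ℝ | (Hmat W β).PosDef}
    (fun β =>
      (2 / Real.pi) ^ ((Fintype.card V : ℝ) / 2) *
        Real.exp (-(1 / 2) * (θ ⬝ᵥ Hmat W β *ᵥ θ)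
          - (1 / 2) * (η ⬝ᵥ (Hmat W β)⁻¹ *ᵥ η) + η ⬝ᵥ θ) *
        (∏ i, θ i) / Real.sqrt (Hmat W β).det) β

/-- The measure `ν_V^{W,θ,η}` on `ℝ^V`. -/
noncomputable def nu [Fintype V] [DecidableEq V] (W : Matrix V V ℝ) (θ η : V → ℝ) :
    Measure (V → ℝ) :=
  volume.withDensity (fun β => ENNReal.ofReal (nuDensity W θ η β))

lemma aux_gauss : ∫⁻ x : ℝ, ENNReal.ofReal (Real.exp (-(x ^ 2) / 2)) =
    ENNReal.ofReal (Real.sqrt (2 * Real.pi)) := by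
  have h1 := integral_gaussian (1 / 2)
  have h2 := integrable_exp_neg_mul_sq (b := 1 / 2) (by norm_num)
  have h3 := ofReal_integral_eq_lintegral_ofReal h2 (ae_of_all _ fun x => (Real.exp_pos _).le)
  rw [h1] at h3
  convert h3.symm using 1
  · congr 1; ext s; congr 2; ring
  · congr 2; ring

lemma aux_cs (z y : ℝ) (hz : 0 < z) (hy : 0 ≤ y) :
    ∫⁻ s in Set.Ioi (0 : ℝ), ENNReal.ofReal (2 * z * Real.exp (-((z * s - y / s) ^ 2) / 2)) =
    ENNReal.ofReal (Real.sqrt (2 * Real.pi)) := by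
  rcases hy.eq_or_lt with rfl | hy
  · have h1 := integral_gaussian_Ioi (z ^ 2 / 2)
    have h2 : Integrable (fun x : ℝ => 2 * z * Real.exp (-(z ^ 2 / 2) * x ^ 2))
        (volume.restrict (Set.Ioi 0)) :=
      ((integrable_exp_neg_mul_sq (b := z ^ 2 / 2) (by positivity)).const_mul _).restrict
    have h3 := ofReal_integral_eq_lintegral_ofReal h2 (ae_of_all _ fun x => by
      have := (Real.exp_pos (-(z ^ 2 / 2) * x ^ 2)).le
      positivity)
    rw [integral_const_mul, h1] at h3
    convert h3.symm using 1
    · congr 1; ext s; congr 3; ring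
    · congr 1
      have : Real.pi / (z ^ 2 / 2) = (2 * Real.pi) / z ^ 2 := by field_simp
      rw [this, Real.sqrt_div' _ (by positivity), Real.sqrt_sq hz.le]
      field_simp
  · have hA := lintegral_image_eq_lintegral_abs_deriv_mul (s := Set.Ioi (0 : ℝ))
      (f := fun s => z * s - y / s) (f' := fun s => z + y / s ^ 2) measurableSet_Ioi
      (fun x hx => by
        have hx : (x : ℝ) ≠ 0 := ne_of_gt hx
        have := ((hasDerivAt_id x).const_mul z).sub ((hasDerivAt_inv hx).const_mul y)
        refine (this.congr_deriv ?_).hasDerivWithinAt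
        (try field_simp) <;> (try ring)) (by
        intro a ha b hb hab
        simp only [Set.mem_Ioi] at ha hb
        have h : z * a - y / a = z * b - y / b := hab
        field_simp at h
        have : (a - b) * (z * a * b + y) = 0 := by linear_combination h
        rcases mul_eq_zero.1 this with h | h
        · linarith
        · have : 0 < z * a * b + y := by positivity
          linarith) (fun x => ENNReal.ofReal (Real.exp (-(x ^ 2) / 2)))
    have him : (fun s => z * s - y / s) '' Set.Ioi (0 : ℝ) = Set.univ := by
      apply Set.eq_univ_of_forall
      intro v
      have hlt : |v| < Real.sqrt (v ^ 2 + 4 * z * y) := by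
        rw [← Real.sqrt_sq_eq_abs]
        exact Real.sqrt_lt_sqrt (sq_nonneg _) (by nlinarith [mul_pos hz hy])
      have hsq : Real.sqrt (v ^ 2 + 4 * z * y) ^ 2 = v ^ 2 + 4 * z * y :=
        Real.sq_sqrt (by positivity)
      set r := Real.sqrt (v ^ 2 + 4 * z * y)
      have hpos : 0 < v + r := by linarith [neg_abs_le v]
      refine ⟨(v + r) / (2 * z), by simp only [Set.mem_Ioi]; positivity, ?_⟩
      simp only
      field_simp
      linear_combination hsq
    rw [him, setLIntegral_univ, aux_gauss] at hA
    have hB := lintegral_image_eq_lintegral_abs_deriv_mul (s := Set.Ioi (0 : ℝ))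
      (f := fun s => y / z / s) (f' := fun s => - (y / z) / s ^ 2) measurableSet_Ioi
      (fun x hx => by
        have hx : (x : ℝ) ≠ 0 := ne_of_gt hx
        have := ((hasDerivAt_inv hx).const_mul (y / z))
        refine (this.congr_deriv ?_).hasDerivWithinAt
        (try field_simp) <;> (try ring)) (by
        intro a ha b hb hab
        simp only [Set.mem_Ioi] at ha hb
        have h : y / z / a = y / z / b := hab
        field_simp at h
        linarith)
        (fun s => ENNReal.ofReal (z * Real.exp (-((z * s - y / s) ^ 2) / 2)))
    have him2 : (fun s => y / z / s) '' Set.Ioi (0 : ℝ) = Set.Ioi 0 := by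
      ext v
      simp only [Set.mem_image, Set.mem_Ioi]
      constructor
      · rintro ⟨x, hx, rfl⟩; positivity
      · intro hv
        exact ⟨y / z / v, by positivity, by field_simp⟩
    rw [him2] at hB
    rw [hA]
    have e1 : ∀ s ∈ Set.Ioi (0 : ℝ),
        ENNReal.ofReal (2 * z * Real.exp (-((z * s - y / s) ^ 2) / 2)) =
        ENNReal.ofReal (z * Real.exp (-((z * s - y / s) ^ 2) / 2)) +
        ENNReal.ofReal (z * Real.exp (-((z * s - y / s) ^ 2) / 2)) := by
      intro s _
      rw [← ENNReal.ofReal_add (by positivity) (by positivity)]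
      congr 1; ring
    have e2 : ∀ s ∈ Set.Ioi (0 : ℝ),
        ENNReal.ofReal |z + y / s ^ 2| * ENNReal.ofReal (Real.exp (-((z * s - y / s) ^ 2) / 2)) =
        ENNReal.ofReal (z * Real.exp (-((z * s - y / s) ^ 2) / 2)) +
        ENNReal.ofReal |-(y / z) / s ^ 2| * ENNReal.ofReal
          (z * Real.exp (-((z * (y / z / s) - y / (y / z / s)) ^ 2) / 2)) := by
      intro s hs
      simp only [Set.mem_Ioi] at hs
      have q1 : |-(y / z) / s ^ 2| = y / z / s ^ 2 := by
        rw [neg_div, abs_neg, abs_of_pos (by positivity)]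
      have q2 : (z * (y / z / s) - y / (y / z / s)) ^ 2 = (z * s - y / s) ^ 2 := by
        field_simp
        ring
      rw [q1, q2, abs_of_pos (by positivity), ← ENNReal.ofReal_mul (by positivity),
        ← ENNReal.ofReal_mul (by positivity), ← ENNReal.ofReal_add (by positivity) (by positivity)]
      congr 1
      field_simp
    rw [setLIntegral_congr_fun measurableSet_Ioi e1, setLIntegral_congr_fun measurableSet_Ioi e2]
    rw [lintegral_add_left (by fun_prop), lintegral_add_left (by fun_prop), ← hB]

lemma aux_ig (z y g : ℝ) (hz : 0 < z) (hy : 0 ≤ y) (hg : 0 < g) :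
    ∫⁻ a in Set.Ioo (0 : ℝ) (1 / g), ENNReal.ofReal
      (z / Real.sqrt (2 * Real.pi * a ^ 3) / Real.sqrt (1 - a * g) *
        Real.exp (-(1 / 2) * (a / (1 - a * g) * y ^ 2) - z ^ 2 / (2 * a))) =
    ENNReal.ofReal (Real.exp (-(z * y) - z ^ 2 * g / 2)) := by
  have hA := lintegral_image_eq_lintegral_abs_deriv_mul (s := Set.Ioi (0 : ℝ))
      (f := fun s => (s ^ 2 + g)⁻¹) (f' := fun s => - (2 * s) / (s ^ 2 + g) ^ 2) measurableSet_Ioi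
      (fun x hx => by
        have hx : (x : ℝ) ^ 2 + g ≠ 0 := by positivity
        have := (((hasDerivAt_id x).pow 2).add_const g).inv hx
        refine (this.congr_deriv ?_).hasDerivWithinAt
        simp) (by
        intro a ha b hb hab
        simp only [Set.mem_Ioi] at ha hb
        have h : (a ^ 2 + g)⁻¹ = (b ^ 2 + g)⁻¹ := hab
        have h := inv_injective h
        have h : a ^ 2 = b ^ 2 := by linarith
        exact (pow_left_inj₀ ha.le hb.le (by norm_num)).1 h) (fun a => ENNReal.ofReal
      (z / Real.sqrt (2 * Real.pi * a ^ 3) / Real.sqrt (1 - a * g) *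
        Real.exp (-(1 / 2) * (a / (1 - a * g) * y ^ 2) - z ^ 2 / (2 * a))))
  have him : (fun s => (s ^ 2 + g)⁻¹) '' Set.Ioi (0 : ℝ) = Set.Ioo 0 (1 / g) := by
    ext v
    simp only [Set.mem_image, Set.mem_Ioi, Set.mem_Ioo]
    constructor
    · rintro ⟨x, hx, rfl⟩
      refine ⟨by positivity, ?_⟩
      rw [one_div]
      exact inv_strictAnti₀ hg (by nlinarith)
    · rintro ⟨h0, h1⟩
      have h2 : g < v⁻¹ := by
        rw [one_div] at h1
        exact (lt_inv_comm₀ h0 hg).1 h1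
      refine ⟨Real.sqrt (v⁻¹ - g), Real.sqrt_pos.2 (by linarith), ?_⟩
      rw [Real.sq_sqrt (by linarith)]
      simp
  rw [him] at hA
  rw [hA]
  have e : ∀ s ∈ Set.Ioi (0 : ℝ), ENNReal.ofReal |-(2 * s) / (s ^ 2 + g) ^ 2| * ENNReal.ofReal
      (z / Real.sqrt (2 * Real.pi * (s ^ 2 + g)⁻¹ ^ 3) / Real.sqrt (1 - (s ^ 2 + g)⁻¹ * g) *
        Real.exp (-(1 / 2) * ((s ^ 2 + g)⁻¹ / (1 - (s ^ 2 + g)⁻¹ * g) * y ^ 2)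
          - z ^ 2 / (2 * (s ^ 2 + g)⁻¹))) =
      ENNReal.ofReal (Real.exp (-(z * y) - z ^ 2 * g / 2) / Real.sqrt (2 * Real.pi)) *
      ENNReal.ofReal (2 * z * Real.exp (-((z * s - y / s) ^ 2) / 2)) := by
    intro s hs
    simp only [Set.mem_Ioi] at hs
    have hp : 0 < s ^ 2 + g := by positivity
    set r := Real.sqrt (s ^ 2 + g) with hr
    have hrp : 0 < r := Real.sqrt_pos.2 hp
    have hr2 : r ^ 2 = s ^ 2 + g := Real.sq_sqrt hp.le
    have q0 : 1 - (s ^ 2 + g)⁻¹ * g = s ^ 2 / (s ^ 2 + g) := by field_simp; ring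
    have q1 : Real.sqrt (1 - (s ^ 2 + g)⁻¹ * g) = s / r := by
      rw [q0, Real.sqrt_div' _ hp.le, Real.sqrt_sq hs.le]
    have q2 : Real.sqrt (2 * Real.pi * (s ^ 2 + g)⁻¹ ^ 3) = Real.sqrt (2 * Real.pi) / r ^ 3 := by
      rw [← hr2, Real.sqrt_mul (by positivity)]
      have : (r ^ 2)⁻¹ ^ 3 = ((r ^ 3)⁻¹) ^ 2 := by field_simp
      rw [this, Real.sqrt_sq (by positivity)]
      rfl
    have q3 : Real.exp (-(1 / 2) * ((s ^ 2 + g)⁻¹ / (1 - (s ^ 2 + g)⁻¹ * g) * y ^ 2)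
          - z ^ 2 / (2 * (s ^ 2 + g)⁻¹)) = Real.exp (-(z * y) - z ^ 2 * g / 2) *
          Real.exp (-((z * s - y / s) ^ 2) / 2) := by
      rw [← Real.exp_add, q0]
      congr 1
      field_simp
      ring
    rw [q1, q2, q3, ← ENNReal.ofReal_mul (by positivity), ← ENNReal.ofReal_mul (by positivity)]
    rw [neg_div, abs_neg, abs_of_pos (by positivity), ← hr2]
    congr 1
    have : 0 < Real.sqrt (2 * Real.pi) := by positivity
    field_simp
  rw [setLIntegral_congr_fun measurableSet_Ioi e, lintegral_const_mul _ (by fun_prop),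
    aux_cs z y hz hy, ← ENNReal.ofReal_mul (by positivity)]
  congr 1
  have : 0 < Real.sqrt (2 * Real.pi) := by positivity
  field_simp

section mats
variable [Fintype V] [DecidableEq V]

lemma aux_dot_symm {M : Matrix V V ℝ} (hM : M.IsSymm) (x y : V → ℝ) :
    x ⬝ᵥ M *ᵥ y = y ⬝ᵥ M *ᵥ x := by
  rw [dotProduct_mulVec, dotProduct_comm, ← mulVec_transpose, hM.eq]

lemma aux_pd_pos {M : Matrix V V ℝ} (hM : M.PosDef) {x : V → ℝ} (hx : x ≠ 0) :
    0 < x ⬝ᵥ M *ᵥ x := by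
  simpa using hM.dotProduct_mulVec_pos hx

lemma aux_pd_nonneg {M : Matrix V V ℝ} (hM : M.PosDef) (x : V → ℝ) :
    0 ≤ x ⬝ᵥ M *ᵥ x := by
  simpa using hM.posSemidef.dotProduct_mulVec_nonneg x

lemma aux_inv_nonneg {M : Matrix V V ℝ} (hM : M.PosDef) (hoff : ∀ i j, i ≠ j → M i j ≤ 0)
    (b : V → ℝ) (hb : ∀ i, 0 ≤ b i) (i : V) : 0 ≤ (M⁻¹ *ᵥ b) i := by
  set x := M⁻¹ *ᵥ b with hx
  have hMx : M *ᵥ x = b := by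
    rw [hx, mulVec_mulVec, Matrix.mul_nonsing_inv _ ((isUnit_iff_isUnit_det _).1 hM.isUnit),
      one_mulVec]
  let n : V → ℝ := fun i => max (-x i) 0
  have h1 : n ⬝ᵥ M *ᵥ (n + x) ≤ 0 := by
    simp only [dotProduct, mulVec, Finset.mul_sum]
    apply Finset.sum_nonpos; intro j _
    apply Finset.sum_nonpos; intro k _
    have hp : 0 ≤ (n + x) k := by
      simp only [Pi.add_apply, n]; linarith [le_max_left (-x k) 0]
    have hn : 0 ≤ n j := le_max_right _ _
    by_cases hjk : j = k
    · subst hjk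
      have : n j * (n + x) j = 0 := by
        simp only [Pi.add_apply, n]
        rcases le_total (-x j) 0 with h | h
        · rw [max_eq_right h]; simp
        · rw [max_eq_left h]; simp
      apply le_of_eq
      linear_combination M j j * this
    · have := mul_nonpos_of_nonpos_of_nonneg (hoff j k hjk) hp
      exact mul_nonpos_of_nonneg_of_nonpos hn this
  rw [mulVec_add, dotProduct_add, hMx] at h1
  have h2 : 0 ≤ n ⬝ᵥ b := Finset.sum_nonneg fun j _ => mul_nonneg (le_max_right _ _) (hb j)
  have h3 : n = 0 := by
    by_contra h
    have := aux_pd_pos hM h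
    linarith
  have h4 : max (-x i) 0 = 0 := congrFun h3 i
  have := le_max_left (-x i) 0
  linarith

lemma aux_sub_mulVec (M : Matrix V V ℝ) (i : V) (a : ℝ) (x : V → ℝ) :
    (M - diagonal (Pi.single i a)) *ᵥ x = M *ᵥ x - (a * x i) • Pi.single i 1 := by
  rw [sub_mulVec]
  congr 1
  ext j
  rw [mulVec_diagonal]
  by_cases h : j = i
  · subst h; simp
  · simp [h]

lemma aux_det (M : Matrix V V ℝ) (hM : IsUnit M.det) (i : V) (a : ℝ) :
    (M - diagonal (Pi.single i a)).det = M.det * (1 - a * M⁻¹ i i) := by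
  have : M - diagonal (Pi.single i a) =
      M + replicateCol Unit (Pi.single i (-a) : V → ℝ) * replicateRow Unit (Pi.single i (1:ℝ)) := by
    rw [sub_eq_add_neg]
    congr 1
    ext j k
    simp only [Matrix.neg_apply, diagonal_apply, Matrix.mul_apply, replicateCol_apply,
      replicateRow_apply, Pi.single_apply]
    by_cases h : j = k
    · subst h; by_cases h' : j = i <;> simp [h']
    · by_cases h' : j = i
      · subst h'; simp [h, Ne.symm h]
      · simp [h, h']
  rw [this, det_add_replicateCol_mul_replicateRow hM, det_unique (n := Unit)]
  congr 1
  simp only [Matrix.add_apply, Matrix.one_apply_eq, Matrix.mul_apply, replicateCol_apply,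
      replicateRow_apply, Pi.single_apply]
  simp
  ring

lemma aux_inv_symm {M : Matrix V V ℝ} (hM : M.IsSymm) : (M⁻¹).IsSymm := by
  rw [Matrix.IsSymm, transpose_nonsing_inv, hM.eq]

lemma aux_e_dot (M : Matrix V V ℝ) (i : V) (x : V → ℝ) :
    (Pi.single i 1 : V → ℝ) ⬝ᵥ M *ᵥ x = (M *ᵥ x) i := by
  simp

lemma aux_eMe (M : Matrix V V ℝ) (i : V) :
    (M *ᵥ (Pi.single i 1 : V → ℝ)) i = M i i := by
  simp

lemma aux_posDef_sub {M : Matrix V V ℝ} (hs : M.IsSymm) (hM : M.PosDef) (i : V) (a : ℝ)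
    (ha : 0 < a) (hag : a * M⁻¹ i i < 1) : (M - diagonal (Pi.single i a)).PosDef := by
  have hg : 0 < M⁻¹ i i := hM.inv.diag_pos
  have hu := (isUnit_iff_isUnit_det _).1 hM.isUnit
  refine Matrix.PosDef.of_dotProduct_mulVec_pos ?_ ?_
  · exact hM.isHermitian.sub (isHermitian_diagonal _)
  · intro x hx
    have hpos := aux_pd_pos hM hx
    rw [aux_sub_mulVec, star_trivial, dotProduct_sub, dotProduct_smul]
    have e1 : x ⬝ᵥ (Pi.single i 1 : V → ℝ) = x i := by simp
    rw [e1, smul_eq_mul]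
    set g := M⁻¹ i i
    set w := M⁻¹ *ᵥ (Pi.single i 1 : V → ℝ) with hw
    have hMw : M *ᵥ w = Pi.single i 1 := by
      rw [hw, mulVec_mulVec, Matrix.mul_nonsing_inv _ hu, one_mulVec]
    have hwi : w i = g := by simp [hw, g]
    have h := aux_pd_nonneg hM (x - (x i / g) • w)
    have e2 : (x - (x i / g) • w) ⬝ᵥ M *ᵥ (x - (x i / g) • w) =
        x ⬝ᵥ M *ᵥ x - x i ^ 2 / g := by
      rw [mulVec_sub, mulVec_smul, hMw]
      simp only [sub_dotProduct, dotProduct_sub, smul_dotProduct, dotProduct_smul]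
      rw [aux_dot_symm hs w x, hMw]
      simp only [dotProduct_single, smul_eq_mul, mul_one, hwi]
      field_simp
      ring
    rw [e2] at h
    have h2 : x i ^ 2 ≤ g * (x ⬝ᵥ M *ᵥ x) := by
      have : x i ^ 2 / g ≤ x ⬝ᵥ M *ᵥ x := by linarith
      rw [div_le_iff₀ hg] at this
      linarith
    nlinarith [mul_le_mul_of_nonneg_left h2 ha.le]

lemma aux_posDef_of_sub {M : Matrix V V ℝ} (i : V) (a : ℝ)
    (ha : 0 < a) (h : (M - diagonal (Pi.single i a)).PosDef) : M.PosDef := by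
  have h2 : (diagonal (Pi.single i a : V → ℝ)).PosSemidef := by
    apply Matrix.PosSemidef.diagonal
    intro j
    by_cases h : j = i
    · subst h; simp [ha.le]
    · simp [h]
  simpa using h.add_posSemidef h2

lemma aux_quad {M : Matrix V V ℝ} (hs : M.IsSymm) (hM : M.PosDef) (i : V) (a : ℝ)
    (ha : 0 < a) (hag : a * M⁻¹ i i < 1) (η : V → ℝ) :
    η ⬝ᵥ (M - diagonal (Pi.single i a))⁻¹ *ᵥ η =
      η ⬝ᵥ M⁻¹ *ᵥ η + a / (1 - a * M⁻¹ i i) * ((M⁻¹ *ᵥ η) i) ^ 2 := by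
  have hu := (isUnit_iff_isUnit_det _).1 hM.isUnit
  have hu' := (isUnit_iff_isUnit_det _).1 (aux_posDef_sub hs hM i a ha hag).isUnit
  set g := M⁻¹ i i with hg
  set y := (M⁻¹ *ᵥ η) i with hy
  have hne : 1 - a * g ≠ 0 := by linarith
  set w := M⁻¹ *ᵥ (Pi.single i 1 : V → ℝ) with hw
  have hMw : M *ᵥ w = Pi.single i 1 := by
    rw [hw, mulVec_mulVec, Matrix.mul_nonsing_inv _ hu, one_mulVec]
  have hwi : w i = g := by simp [hw, g]
  have key : (M - diagonal (Pi.single i a)) *ᵥ (M⁻¹ *ᵥ η + (a * y / (1 - a * g)) • w) = η := by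
    rw [aux_sub_mulVec, mulVec_add, mulVec_smul, hMw, mulVec_mulVec, Matrix.mul_nonsing_inv _ hu,
      one_mulVec, Pi.add_apply, Pi.smul_apply, hwi, ← hy, add_sub_assoc, ← sub_smul]
    have : a * y / (1 - a * g) - a * (y + (a * y / (1 - a * g)) • g) = 0 := by
      rw [smul_eq_mul]; field_simp; ring
    rw [this]; simp
  have key2 : (M - diagonal (Pi.single i a))⁻¹ *ᵥ η = M⁻¹ *ᵥ η + (a * y / (1 - a * g)) • w := by
    conv_lhs => rw [← key]
    rw [mulVec_mulVec, Matrix.nonsing_inv_mul _ hu', one_mulVec]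
  rw [key2, dotProduct_add, dotProduct_smul, hw, aux_dot_symm (aux_inv_symm hs) η (Pi.single i 1),
    aux_e_dot, ← hy, smul_eq_mul]
  ring

lemma aux_Hmat_update (W : Matrix V V ℝ) (β : V → ℝ) (i : V) (a : ℝ) :
    Hmat W (Function.update β i (β i - a / 2)) = Hmat W β - diagonal (Pi.single i a) := by
  ext j k
  simp only [Hmat, Matrix.sub_apply, diagonal_apply]
  by_cases h : j = k
  · subst h
    by_cases h' : j = i
    · subst h'; simp; ring
    · simp [h']
  · simp [h]

lemma aux_Hmat_symm {W : Matrix V V ℝ} (hW : W.IsSymm) (β : V → ℝ) : (Hmat W β).IsSymm := by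
  simp [Hmat, Matrix.IsSymm, transpose_sub, hW.eq]

lemma aux_meas (W : Matrix V V ℝ) (hW : W.IsSymm) (θ η : V → ℝ) :
    Measurable (nuDensity W θ η) := by
  have hent : ∀ i j, Measurable fun β : V → ℝ => Hmat W β i j := by
    intro i j
    simp only [Hmat, Matrix.sub_apply, diagonal_apply]
    by_cases h : i = j
    · simp only [h, if_true]; fun_prop
    · simp only [h, if_false]; fun_prop
  have hcont : Continuous (Hmat W) := by
    unfold Hmat
    fun_prop
  have hdet : Continuous fun β : V → ℝ => (Hmat W β).det := hcont.matrix_det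
  have hset : MeasurableSet {β : V → ℝ | (Hmat W β).PosDef} := by
    have : {β : V → ℝ | (Hmat W β).PosDef} =
        (⋂ x : V → ℝ, {β | 0 ≤ x ⬝ᵥ Hmat W β *ᵥ x}) ∩ {β | (Hmat W β).det ≠ 0} := by
      ext β
      simp only [Set.mem_inter_iff, Set.mem_iInter, Set.mem_setOf_eq]
      constructor
      · intro h
        exact ⟨fun x => aux_pd_nonneg h x, h.det_pos.ne'⟩
      · rintro ⟨h1, h2⟩
        have : (Hmat W β).PosSemidef := by
          refine Matrix.PosSemidef.of_dotProduct_mulVec_nonneg ?_ ?_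
          · rw [Matrix.IsHermitian, conjTranspose_eq_transpose_of_trivial]
            exact aux_Hmat_symm hW β
          · intro x; simpa using h1 x
        exact this.posDef_iff_det_ne_zero.2 h2
    rw [this]
    refine (isClosed_iInter fun x => ?_).measurableSet.inter
      (isOpen_ne_fun hdet continuous_const).measurableSet
    exact isClosed_le continuous_const (by fun_prop)
  refine Measurable.indicator ?_ hset
  have hinv : ∀ i j, Measurable fun β : V → ℝ => (Hmat W β)⁻¹ i j := by
    intro i j
    simp only [Matrix.inv_def, Ring.inverse_eq_inv', Matrix.smul_apply, smul_eq_mul]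
    exact hdet.measurable.inv.mul (hcont.matrix_adjugate.matrix_elem i j).measurable
  have h1 : Measurable fun β : V → ℝ => η ⬝ᵥ (Hmat W β)⁻¹ *ᵥ η := by
    simp only [dotProduct, mulVec]
    exact Finset.measurable_sum _ fun i _ => (Finset.measurable_sum _ fun j _ =>
      (hinv i j).mul_const _).const_mul _
  have h2 : Measurable fun β : V → ℝ => θ ⬝ᵥ Hmat W β *ᵥ θ := by
    simp only [dotProduct, mulVec]
    exact Finset.measurable_sum _ fun i _ => (Finset.measurable_sum _ fun j _ =>
      (hent i j).mul_const _).const_mul _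
  have h3 := hdet.measurable
  fun_prop

end mats

lemma aux_nu_neg [Fintype V] [DecidableEq V] {W : Matrix V V ℝ} {θ η β : V → ℝ}
    (h : ¬ (Hmat W β).PosDef) : nuDensity W θ η β = 0 := by
  unfold nuDensity
  exact Set.indicator_of_notMem (s := {β : V → ℝ | (Hmat W β).PosDef}) h _

lemma aux_nu_pos [Fintype V] [DecidableEq V] {W : Matrix V V ℝ} {θ η β : V → ℝ}
    (h : (Hmat W β).PosDef) : nuDensity W θ η β =
      (2 / Real.pi) ^ ((Fintype.card V : ℝ) / 2) *
        Real.exp (-(1 / 2) * (θ ⬝ᵥ Hmat W β *ᵥ θ)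
          - (1 / 2) * (η ⬝ᵥ (Hmat W β)⁻¹ *ᵥ η) + η ⬝ᵥ θ) *
        (∏ i, θ i) / Real.sqrt (Hmat W β).det := by
  unfold nuDensity
  exact Set.indicator_of_mem (s := {β : V → ℝ | (Hmat W β).PosDef}) h _

lemma aux_key [Fintype V] [DecidableEq V]
    (W : Matrix V V ℝ) (hWsymm : W.IsSymm) (hWpos : ∀ i j, 0 ≤ W i j)
    (θ η : V → ℝ) (hθ : ∀ i, 0 < θ i) (hη : ∀ i, 0 ≤ η i) (i : V) (z : ℝ) (hz : 0 < z)
    (β : V → ℝ) :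
    ∫⁻ a, ENNReal.ofReal (nuDensity W θ η (Function.update β i (β i - a / 2)))
      ∂(volume.withDensity (fun t : ℝ => ENNReal.ofReal
            (if 0 < t then
              z / Real.sqrt (2 * Real.pi * t ^ 3) *
                Real.exp (-(z - θ i * t) ^ 2 / (2 * t))
            else 0))) =
    ENNReal.ofReal (nuDensity W θ (Function.update η i (η i + z)) β) := by
  have hm : Measurable (fun t : ℝ => ENNReal.ofReal
            (if 0 < t then
              z / Real.sqrt (2 * Real.pi * t ^ 3) *
                Real.exp (-(z - θ i * t) ^ 2 / (2 * t))
            else 0)) := by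
    refine ENNReal.measurable_ofReal.comp (Measurable.ite measurableSet_Ioi ?_ measurable_const)
    fun_prop
  rw [lintegral_withDensity_eq_lintegral_mul_non_measurable _ hm
    (ae_of_all _ fun x => ENNReal.ofReal_lt_top)]
  by_cases hH : (Hmat W β).PosDef
  swap
  · have h0 : nuDensity W θ (Function.update η i (η i + z)) β = 0 :=
      aux_nu_neg hH
    rw [h0, ENNReal.ofReal_zero]
    have : ∀ a : ℝ, ((fun t : ℝ => ENNReal.ofReal
            (if 0 < t then
              z / Real.sqrt (2 * Real.pi * t ^ 3) *
                Real.exp (-(z - θ i * t) ^ 2 / (2 * t))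
            else 0)) * fun a => ENNReal.ofReal
              (nuDensity W θ η (Function.update β i (β i - a / 2)))) a = 0 := by
      intro a
      simp only [Pi.mul_apply]
      by_cases ha : 0 < a
      · have h1 : nuDensity W θ η (Function.update β i (β i - a / 2)) = 0 := by
          apply aux_nu_neg
          intro h
          rw [aux_Hmat_update] at h
          exact hH (aux_posDef_of_sub i a ha h)
        rw [h1]; simp
      · rw [if_neg ha]; simp
    rw [lintegral_congr this, lintegral_zero]
  · have hs := aux_Hmat_symm hWsymm β
    have hu := (isUnit_iff_isUnit_det _).1 hH.isUnit
    have hg : 0 < (Hmat W β)⁻¹ i i := hH.inv.diag_pos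
    have hy : 0 ≤ ((Hmat W β)⁻¹ *ᵥ η) i := by
      apply aux_inv_nonneg hH _ _ hη
      intro j k hjk
      simp [Hmat, diagonal_apply_ne _ hjk, hWpos j k]
    have hdet := hH.det_pos
    have hq1 : (Function.update η i (η i + z)) = η + z • Pi.single i 1 := by
      ext j
      by_cases h : j = i
      · subst h; simp
      · simp [h]
    have hq2 : (η + z • Pi.single i 1) ⬝ᵥ (Hmat W β)⁻¹ *ᵥ (η + z • Pi.single i 1) =
        η ⬝ᵥ (Hmat W β)⁻¹ *ᵥ η + 2 * z * ((Hmat W β)⁻¹ *ᵥ η) i + z ^ 2 * (Hmat W β)⁻¹ i i := by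
      rw [mulVec_add, mulVec_smul, add_dotProduct, dotProduct_add, dotProduct_add, smul_dotProduct,
        smul_dotProduct, dotProduct_smul, dotProduct_smul,
        aux_dot_symm (aux_inv_symm hs) η (Pi.single i 1), aux_e_dot, aux_e_dot, aux_eMe]
      simp only [smul_eq_mul]
      ring
    have hq3 : (η + z • Pi.single i 1) ⬝ᵥ θ = η ⬝ᵥ θ + z * θ i := by
      rw [add_dotProduct, smul_dotProduct]; simp
    have hR : nuDensity W θ (Function.update η i (η i + z)) β = _ :=
      aux_nu_pos hH
    rw [hR, hq1, hq2, hq3]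
    have hL := aux_ig z _ _ hz hy hg
    set g := (Hmat W β)⁻¹ i i with hgdef
    set y := ((Hmat W β)⁻¹ *ᵥ η) i with hydef
    have hP : 0 < ∏ i, θ i := Finset.prod_pos fun i _ => hθ i
    set C : ℝ := (2 / Real.pi) ^ ((Fintype.card V : ℝ) / 2) *
        Real.exp (-(1 / 2) * (θ ⬝ᵥ Hmat W β *ᵥ θ)
          - (1 / 2) * (η ⬝ᵥ (Hmat W β)⁻¹ *ᵥ η) + (η ⬝ᵥ θ + z * θ i)) *
        (∏ i, θ i) / Real.sqrt (Hmat W β).det with hC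
    have hC0 : 0 ≤ C := by positivity
    have hpt : ∀ a : ℝ, ((fun t : ℝ => ENNReal.ofReal
            (if 0 < t then
              z / Real.sqrt (2 * Real.pi * t ^ 3) *
                Real.exp (-(z - θ i * t) ^ 2 / (2 * t))
            else 0)) * fun a => ENNReal.ofReal
              (nuDensity W θ η (Function.update β i (β i - a / 2)))) a =
        (Set.Ioo (0 : ℝ) (1 / g)).indicator (fun a => ENNReal.ofReal C * ENNReal.ofReal
      (z / Real.sqrt (2 * Real.pi * a ^ 3) / Real.sqrt (1 - a * g) *
        Real.exp (-(1 / 2) * (a / (1 - a * g) * y ^ 2) - z ^ 2 / (2 * a)))) a := by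
      intro a
      simp only [Pi.mul_apply]
      by_cases ha : 0 < a
      swap
      · rw [if_neg ha, Set.indicator_of_notMem (fun h => ha h.1)]; simp
      by_cases hag : a * g < 1
      · have hmem : a ∈ Set.Ioo (0 : ℝ) (1 / g) := ⟨ha, by rwa [lt_div_iff₀ hg]⟩
        rw [Set.indicator_of_mem hmem, if_pos ha]
        have hpd := aux_posDef_sub hs hH i a ha hag
        have hN : nuDensity W θ η (Function.update β i (β i - a / 2)) = _ :=
          aux_nu_pos (by rw [aux_Hmat_update]; exact hpd)
        rw [hN, aux_Hmat_update, aux_quad hs hH i a ha hag, aux_det _ hu, aux_sub_mulVec,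
          dotProduct_sub, dotProduct_smul, Real.sqrt_mul hdet.le, ← hgdef, ← hydef]
        have e1 : θ ⬝ᵥ (Pi.single i 1 : V → ℝ) = θ i := by simp
        rw [e1, smul_eq_mul, ← ENNReal.ofReal_mul (by positivity), ← ENNReal.ofReal_mul hC0]
        congr 1
        have h1 : 0 < Real.sqrt (1 - a * g) := Real.sqrt_pos.2 (by linarith)
        have h2 : 0 < Real.sqrt (Hmat W β).det := Real.sqrt_pos.2 hdet
        have hex : Real.exp (-(z - θ i * a) ^ 2 / (2 * a)) *
            Real.exp (-(1 / 2) * (θ ⬝ᵥ Hmat W β *ᵥ θ - a * θ i * θ i) -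
              1 / 2 * (η ⬝ᵥ (Hmat W β)⁻¹ *ᵥ η + a / (1 - a * g) * y ^ 2) + η ⬝ᵥ θ) =
            Real.exp (-(1 / 2) * (θ ⬝ᵥ Hmat W β *ᵥ θ)
              - (1 / 2) * (η ⬝ᵥ (Hmat W β)⁻¹ *ᵥ η) + (η ⬝ᵥ θ + z * θ i)) *
            Real.exp (-(1 / 2) * (a / (1 - a * g) * y ^ 2) - z ^ 2 / (2 * a)) := by
          rw [← Real.exp_add, ← Real.exp_add]
          congr 1
          have : -(z - θ i * a) ^ 2 / (2 * a) = -(z ^ 2 / (2 * a)) + z * θ i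
            - θ i * θ i * a / 2 := by field_simp; ring
          rw [this]
          ring
        rw [hC]
        generalize Real.exp (-(z - θ i * a) ^ 2 / (2 * a)) = E1 at hex ⊢
        generalize Real.exp (-(1 / 2) * (θ ⬝ᵥ Hmat W β *ᵥ θ - a * θ i * θ i) -
              1 / 2 * (η ⬝ᵥ (Hmat W β)⁻¹ *ᵥ η + a / (1 - a * g) * y ^ 2) + η ⬝ᵥ θ) = E2 at hex ⊢
        generalize Real.exp (-(1 / 2) * (a / (1 - a * g) * y ^ 2) - z ^ 2 / (2 * a)) = E3 at hex ⊢
        generalize Real.exp (-(1 / 2) * (θ ⬝ᵥ Hmat W β *ᵥ θ)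
              - (1 / 2) * (η ⬝ᵥ (Hmat W β)⁻¹ *ᵥ η) + (η ⬝ᵥ θ + z * θ i)) = E4 at hex ⊢
        generalize (2 / Real.pi) ^ ((Fintype.card V : ℝ) / 2) = K
        simp only [div_eq_mul_inv, mul_inv]
        linear_combination z * (√(2 * Real.pi * a ^ 3))⁻¹ * K * (∏ i, θ i) *
          (√(Hmat W β).det)⁻¹ * (√(1 - a * g))⁻¹ * hex
      · rw [Set.indicator_of_notMem (fun h => hag (by rw [← lt_div_iff₀ hg]; exact h.2))]
        have h1 : nuDensity W θ η (Function.update β i (β i - a / 2)) = 0 := by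
          apply aux_nu_neg
          intro h
          rw [aux_Hmat_update] at h
          have h3 := h.det_pos
          rw [aux_det _ hu, ← hgdef] at h3
          have := pos_of_mul_pos_right h3 hdet.le
          linarith
        rw [h1]; simp
    rw [lintegral_congr hpt, lintegral_indicator measurableSet_Ioo,
      lintegral_const_mul' _ _ ENNReal.ofReal_ne_top, hL, ← ENNReal.ofReal_mul hC0]
    congr 1
    have hex : Real.exp (-(1 / 2) * (θ ⬝ᵥ Hmat W β *ᵥ θ)
          - (1 / 2) * (η ⬝ᵥ (Hmat W β)⁻¹ *ᵥ η) + (η ⬝ᵥ θ + z * θ i)) *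
        Real.exp (-(z * y) - z ^ 2 * g / 2) =
        Real.exp (-(1 / 2) * (θ ⬝ᵥ Hmat W β *ᵥ θ)
          - (1 / 2) * (η ⬝ᵥ (Hmat W β)⁻¹ *ᵥ η + 2 * z * y + z ^ 2 * g)
            + (η ⬝ᵥ θ + z * θ i)) := by
      rw [← Real.exp_add]
      congr 1
      ring
    rw [← hex, hC]
    ring

lemma aux_marg [Fintype V] [DecidableEq V]
    (W : Matrix V V ℝ) (hWsymm : W.IsSymm) (hWpos : ∀ i j, 0 ≤ W i j)
    (θ η : V → ℝ) (hθ : ∀ i, 0 < θ i) (hη : ∀ i, 0 ≤ η i)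
    (ζ : V → ℝ) (hζ : ∀ i, 0 < ζ i) (β : V → ℝ) (s : Finset V) :
    ∀ x : V → ℝ, lmarginal (fun i => volume.withDensity (fun t : ℝ => ENNReal.ofReal
            (if 0 < t then
              ζ i / Real.sqrt (2 * Real.pi * t ^ 3) *
                Real.exp (-(ζ i - θ i * t) ^ 2 / (2 * t))
            else 0))) s
      (fun x => ENNReal.ofReal (nuDensity W θ η (fun j => β j - x j / 2))) x =
    ENNReal.ofReal (nuDensity W θ (fun j => if j ∈ s then η j + ζ j else η j)
      (fun j => if j ∈ s then β j else β j - x j / 2)) := by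
  induction s using Finset.induction_on with
  | empty => intro x; simp
  | insert i s hi ih =>
    intro x
    have hmeas : Measurable
        (fun x : V → ℝ => ENNReal.ofReal (nuDensity W θ η (fun j => β j - x j / 2))) :=
      ENNReal.measurable_ofReal.comp ((aux_meas W hWsymm θ η).comp (by fun_prop))
    rw [lmarginal_insert _ hmeas hi]
    simp_rw [ih]
    have := aux_key W hWsymm hWpos θ (fun j => if j ∈ s then η j + ζ j else η j) hθ
      (fun j => by
        have := hη j
        have := (hζ j).le
        by_cases h : j ∈ s
        · simp only [h, if_true]; positivity
        · simpa [h] using hη j) i (ζ i) (hζ i)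
      (fun j => if j ∈ insert i s then β j else β j - x j / 2)
    convert this using 1
    · refine lintegral_congr fun a => ?_
      congr 2
      ext j
      by_cases hj : j = i
      · subst hj; simp [hi]
      · simp [hj]
    · congr 2
      ext j
      by_cases hj : j = i
      · subst hj; simp [hi]
      · simp [hj]

/-- If `δ ∼ ν_V^{W,θ,η}` and, independently, `A_i ∼ IG(ζ_i/θ_i, ζ_i²)` are independent,
then `δ + A/2 ∼ ν_V^{W,θ,η+ζ}`. -/
theorem nu_add_halfIG [Fintype V] [DecidableEq V] [Nonempty V]
    (W : Matrix V V ℝ) (hWsymm : W.IsSymm) (hWpos : ∀ i j, 0 ≤ W i j)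
    (θ η : V → ℝ) (hθ : ∀ i, 0 < θ i) (hη : ∀ i, 0 ≤ η i)
    (ζ : V → ℝ) (hζ : ∀ i, 0 < ζ i) :
    Measure.map (fun p : (V → ℝ) × (V → ℝ) => fun i => p.1 i + p.2 i / 2)
        ((nu W θ η).prod
          (Measure.pi fun i => volume.withDensity (fun t : ℝ => ENNReal.ofReal
            (if 0 < t then
              ζ i / Real.sqrt (2 * Real.pi * t ^ 3) *
                Real.exp (-(ζ i - θ i * t) ^ 2 / (2 * t))
            else 0)))) =
      nu W θ (fun i => η i + ζ i) := by
  have hmap : Measurable (fun p : (V → ℝ) × (V → ℝ) => fun i => p.1 i + p.2 i / 2) := by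
    fun_prop
  have hD : Measurable (fun β => ENNReal.ofReal (nuDensity W θ η β)) :=
    ENNReal.measurable_ofReal.comp (aux_meas W hWsymm θ η)
  set μ : V → Measure ℝ := fun i => volume.withDensity (fun t : ℝ => ENNReal.ofReal
            (if 0 < t then
              ζ i / Real.sqrt (2 * Real.pi * t ^ 3) *
                Real.exp (-(ζ i - θ i * t) ^ 2 / (2 * t))
            else 0)) with hμ
  have hσ : ∀ i, SigmaFinite (μ i) := fun i => SigmaFinite.withDensity_ofReal _
  refine Measure.ext_of_lintegral _ fun f hf => ?_
  have hfm : Measurable (fun p : (V → ℝ) × (V → ℝ) => f (fun i => p.1 i + p.2 i / 2)) :=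
    hf.comp hmap
  rw [lintegral_map hf hmap]
  unfold nu
  have : SFinite (volume.withDensity (fun β => ENNReal.ofReal (nuDensity W θ η β))) :=
    inferInstance
  rw [lintegral_prod_symm _ hfm.aemeasurable]
  have h1 : ∀ A : V → ℝ, ∫⁻ δ, f (fun i => δ i + A i / 2)
      ∂(volume.withDensity (fun β => ENNReal.ofReal (nuDensity W θ η β))) =
      ∫⁻ β : V → ℝ, ENNReal.ofReal (nuDensity W θ η (fun j => β j - A j / 2)) * f β := by
    intro A
    have hfA : Measurable (fun δ : V → ℝ => f (fun i => δ i + A i / 2)) :=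
      hf.comp (by fun_prop)
    rw [lintegral_withDensity_eq_lintegral_mul _ hD hfA]
    rw [← lintegral_add_right_eq_self
      (fun β => ENNReal.ofReal (nuDensity W θ η (fun j => β j - A j / 2)) * f β)
      (fun i => A i / 2)]
    refine lintegral_congr fun δ => ?_
    simp only [Pi.mul_apply, Pi.add_apply, add_sub_cancel_right]
    rfl
  simp only [h1]
  rw [lintegral_lintegral_swap]
  · have hD2 : Measurable (fun β => ENNReal.ofReal (nuDensity W θ (fun i => η i + ζ i) β)) :=
      ENNReal.measurable_ofReal.comp (aux_meas W hWsymm θ _)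
    rw [lintegral_withDensity_eq_lintegral_mul _ hD2 hf]
    refine lintegral_congr fun β => ?_
    have hm2 : Measurable
        (fun x : V → ℝ => ENNReal.ofReal (nuDensity W θ η (fun j => β j - x j / 2))) :=
      hD.comp (by fun_prop)
    rw [lintegral_mul_const _ hm2]
    have h2 := aux_marg W hWsymm hWpos θ η hθ hη ζ hζ β Finset.univ 0
    rw [lmarginal_univ] at h2
    simp only [Finset.mem_univ, if_true] at h2
    rw [h2]
    rfl
  · refine Measurable.aemeasurable ?_
    refine Measurable.mul ?_ (hf.comp measurable_snd)
    exact hD.comp (by fun_prop)
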